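/- Let λ ∈ F_{q^n} \ F_q, let t = [F_q(λ):F_q], and let S = ⟨1, λ, …, λ^{k−1}⟩_{F_q} with 1 < k ≤ t/2. Then the code C = Orb(S) ⊆ G_q(n,k) satisfies ω_{2i}(C) = (q+1)·q^{2i−1} for every i ∈ {1,…,k−1}, and ω_{2k}(C) = (q^n − q^{2k−1})/(q − 1). -/

import Mathlib

/-!
Setting: `q` is a prime power, realized by a finite field `Fq` with `Fintype.card Fq = q`;
`F` plays the role of `F_{q^n}`: a finite field extension of `Fq` with `Module.finrank Fq F = n`.
`F_q`-subspaces of `F_{q^n}` are `Submodule Fq F`; for a divisor `t` of `n`, the subfield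
`F_{q^t}` is the (unique) `T : IntermediateField Fq F` with `Module.finrank Fq ↥T = t`, and
`F_{q^t}`-subspaces are `Submodule ↥T F`.
-/

set_option synthInstance.maxHeartbeats 1000000

namespace FWS

variable (R : Type*) {F : Type*} [Field R] [Field F] [Algebra R F]

/-- The cyclic shift `α S = {α * s : s ∈ S}` of an `R`-subspace `S` of `F`. -/
def shift (α : F) (S : Submodule R F) : Submodule R F :=
  S.map (LinearMap.mulLeft R α)

/-- The subspace distance `d(U,V) = dim U + dim V - 2 dim (U ⊓ V)`
(which is `2k - 2 dim (U ⊓ V)` for `U, V` of the same dimension `k`). -/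
noncomputable def sdist (U V : Submodule R F) : ℕ :=
  Module.finrank R ↥U + Module.finrank R ↥V - 2 * Module.finrank R ↥(U ⊓ V)

/-- The one-orbit cyclic subspace code `Orb(S) = {α S : α ∈ F*}`. -/
def orb (S : Submodule R F) : Set (Submodule R F) :=
  {T | ∃ α : F, α ≠ 0 ∧ T = shift R α S}

/-- The weight `ω_{2i}(Orb(S)) = #{α S : α ∈ F*, d(S, α S) = 2 i}`. -/
noncomputable def omega (S : Submodule R F) (i : ℕ) : ℕ :=
  Nat.card {T : Submodule R F // T ∈ orb R S ∧ sdist R S T = 2 * i}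

/-- `Orb(S)` is a full weight spectrum (FWS) code: `ω_{2i} > 0` for all `1 ≤ i ≤ dim S`. -/
def IsFWS (S : Submodule R F) : Prop :=
  ∀ i : ℕ, 1 ≤ i → i ≤ Module.finrank R ↥S → 0 < omega R S i

/-- The subspace `⟨1, l, ..., l^(k-1)⟩_R` spanned by the first `k` powers of `l`. -/
def polySpan (l : F) (k : ℕ) : Submodule R F :=
  Submodule.span R ((fun i : ℕ => l ^ i) '' Set.Iio k)

/-- The invariant `m(Orb(S))`: the least divisor `t` of `n` such that
`dim_{F_{q^t}} ⟨S⟩_{F_{q^t}} = 1` (equivalently, the degree of the smallest subfield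
containing a cyclic shift of `S`). -/
noncomputable def mOrb (S : Submodule R F) : ℕ :=
  sInf {t : ℕ | t ∣ Module.finrank R F ∧
    ∃ T : IntermediateField R F, Module.finrank R ↥T = t ∧
      Module.finrank ↥T ↥(Submodule.span ↥T (S : Set F)) = 1}

/-- The stabilizer `H(S) = {x ∈ F* : x S = S} ∪ {0}` of a set `S ⊆ F`, as a subset of `F`
(it is a subfield of `F` when `S` is a subspace). -/
def stab {F : Type*} [Field F] (S : Set F) : Set F :=
  {x : F | x ≠ 0 ∧ (fun y => x * y) '' S = S} ∪ {0}

end FWS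

namespace FWS

section
open Polynomial

variable {R F : Type*} [Field R] [Field F] [Algebra R F]

theorem polySpan_eq_map_degreeLT (l : F) (m : ℕ) :
    polySpan R l m = (degreeLT R m).map (aeval l).toLinearMap := by
  classical
  rw [degreeLT_eq_span_X_pow, Submodule.map_span, polySpan]
  congr 1
  ext x
  simp

theorem mem_polySpan {l : F} {m : ℕ} {x : F} :
    x ∈ polySpan R l m ↔ ∃ p : R[X], p.degree < m ∧ aeval l p = x := by
  simp [polySpan_eq_map_degreeLT, mem_degreeLT]

theorem mem_shift {α x : F} {S : Submodule R F} : x ∈ shift R α S ↔ ∃ y ∈ S, α * y = x := by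
  simp [shift]

theorem eq_of_aeval_eq {l : F} {p r : R[X]} (hp : p.degree < (minpoly R l).natDegree)
    (hr : r.degree < (minpoly R l).natDegree) (h : aeval l p = aeval l r) : p = r := by
  rw [← sub_eq_zero]
  by_contra h0
  refine h0 (eq_zero_of_dvd_of_natDegree_lt (minpoly.dvd R l (by simp [h])) ?_)
  have := (degree_sub_le p r).trans_lt (max_lt hp hr)
  rwa [degree_eq_natDegree h0, Nat.cast_lt] at this

theorem finrank_degreeLT (m : ℕ) : Module.finrank R (degreeLT R m) = m := by
  simp [(degreeLTEquiv R m).finrank_eq]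

theorem finrank_inf_shift_polySpan_of_reduced {l α : F} {f g : R[X]} {k m : ℕ} (hmk : m ≤ k)
    (hk : 2 * k ≤ (minpoly R l).natDegree) (hf0 : f ≠ 0) (hg0 : g ≠ 0)
    (hf : f.natDegree < k) (hg : g.natDegree < k) (hfg : IsRelPrime f g)
    (hα : α * aeval l g = aeval l f) :
    Module.finrank R ↥(polySpan R l m ⊓ shift R α (polySpan R l m)) =
      m - max f.natDegree g.natDegree := by
  set L : degreeLT R (m - max f.natDegree g.natDegree) →ₗ[R] F :=
    (aeval l).toLinearMap ∘ₗ (LinearMap.mulLeft R f) ∘ₗ Submodule.subtype _ with hL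
  have hLa : ∀ c, L c = aeval l (f * (c : R[X])) := fun c => rfl
  have hdeg : ∀ {c : R[X]}, c.degree < ((m - max f.natDegree g.natDegree : ℕ) : WithBot ℕ) →
      (f * c).degree < m ∧ (g * c).degree < m := by
    intro c hc
    rcases eq_or_ne c 0 with rfl | hc0
    · simp
    · rw [degree_eq_natDegree hc0, Nat.cast_lt] at hc
      rw [degree_eq_natDegree (mul_ne_zero hf0 hc0), degree_eq_natDegree (mul_ne_zero hg0 hc0),
        natDegree_mul hf0 hc0, natDegree_mul hg0 hc0, Nat.cast_lt, Nat.cast_lt]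
      omega
  have hinj : Function.Injective L := by
    intro c d hcd
    rw [hLa, hLa] at hcd
    have hmt : (m : WithBot ℕ) ≤ (minpoly R l).natDegree := by
      rw [Nat.cast_le]; omega
    have := eq_of_aeval_eq ((hdeg (mem_degreeLT.1 c.2)).1.trans_le hmt)
      ((hdeg (mem_degreeLT.1 d.2)).1.trans_le hmt) hcd
    exact Subtype.ext (mul_left_cancel₀ hf0 this)
  have hrange : LinearMap.range L = polySpan R l m ⊓ shift R α (polySpan R l m) := by
    ext x
    simp only [LinearMap.mem_range, Submodule.mem_inf, mem_shift, mem_polySpan, hLa]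
    constructor
    · rintro ⟨c, rfl⟩
      have hc := hdeg (mem_degreeLT.1 c.2)
      refine ⟨⟨_, hc.1, rfl⟩, _, ⟨_, hc.2, rfl⟩, ?_⟩
      rw [map_mul, map_mul, ← mul_assoc, hα]
    · rintro ⟨⟨a, ha, rfl⟩, _, ⟨b, hb, rfl⟩, hab⟩
      have hlt : ∀ {u v : R[X]}, u.degree < m → v ≠ 0 → v.natDegree < k →
          (v * u).degree < (minpoly R l).natDegree := by
        intro u v hu hv0 hv
        rcases eq_or_ne u 0 with rfl | hu0
        · simp
        · rw [degree_eq_natDegree hu0, Nat.cast_lt] at hu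
          rw [degree_eq_natDegree (mul_ne_zero hv0 hu0), natDegree_mul hv0 hu0, Nat.cast_lt]
          omega
      have heq : g * a = f * b := by
        refine eq_of_aeval_eq (hlt ha hg0 hg) (hlt hb hf0 hf) ?_
        rw [map_mul, map_mul, ← hab, ← hα]
        ring
      obtain ⟨c, rfl⟩ : f ∣ a := hfg.dvd_of_dvd_mul_left (heq ▸ dvd_mul_right f b)
      have hbc : b = g * c := mul_left_cancel₀ hf0 (by rw [← heq]; ring)
      subst hbc
      refine ⟨⟨c, ?_⟩, rfl⟩
      rw [mem_degreeLT]
      rcases eq_or_ne c 0 with rfl | hc0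
      · simp
      · rw [degree_eq_natDegree (mul_ne_zero hf0 hc0), natDegree_mul hf0 hc0, Nat.cast_lt] at ha
        rw [degree_eq_natDegree (mul_ne_zero hg0 hc0), natDegree_mul hg0 hc0, Nat.cast_lt] at hb
        rw [degree_eq_natDegree hc0, Nat.cast_lt]
        omega
  rw [← hrange, LinearMap.finrank_range_of_inj hinj, finrank_degreeLT]

theorem exists_finrank_inf_shift_polySpan {l α : F} {k : ℕ}
    (hk : 2 * k ≤ (minpoly R l).natDegree) (hα : α ≠ 0) :
    ∃ e : ℕ, ∀ m ≤ k,
      Module.finrank R ↥(polySpan R l m ⊓ shift R α (polySpan R l m)) = m - e := by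
  by_cases h : ∃ a b : R[X], b ≠ 0 ∧ a.degree < k ∧ b.degree < k ∧ α * aeval l b = aeval l a
  · obtain ⟨a, b, hb0, ha, hb, hab⟩ := h
    have hkt : (k : WithBot ℕ) ≤ (minpoly R l).natDegree := by
      rw [Nat.cast_le]; omega
    have hbl : aeval l b ≠ 0 := fun hbl => hb0 <|
      eq_of_aeval_eq (hb.trans_le hkt) (by simp) (by simpa using hbl)
    have ha0 : a ≠ 0 := by
      rintro rfl
      simp_all
    obtain ⟨f, g, c, hfg, rfl, rfl⟩ := UniqueFactorizationMonoid.exists_reduced_factors' a b hb0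
    have hc0 := left_ne_zero_of_mul ha0
    have hf0 := right_ne_zero_of_mul ha0
    have hg0 := right_ne_zero_of_mul hb0
    rw [degree_eq_natDegree ha0, natDegree_mul hc0 hf0, Nat.cast_lt] at ha
    rw [degree_eq_natDegree hb0, natDegree_mul hc0 hg0, Nat.cast_lt] at hb
    refine ⟨max f.natDegree g.natDegree, fun m hm =>
      finrank_inf_shift_polySpan_of_reduced hm hk hf0 hg0 (by omega) (by omega) hfg ?_⟩
    rw [map_mul] at hbl
    apply mul_left_cancel₀ (left_ne_zero_of_mul hbl)
    rw [map_mul, map_mul] at hab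
    rw [← hab]
    ring
  · refine ⟨k, fun m hm => ?_⟩
    rw [Nat.sub_eq_zero_of_le hm,
      (Submodule.eq_bot_iff (polySpan R l m ⊓ shift R α (polySpan R l m))).2, finrank_bot]
    intro x hx
    simp only [Submodule.mem_inf, mem_shift, mem_polySpan] at hx
    obtain ⟨⟨a, ha, rfl⟩, _, ⟨b, hb, rfl⟩, hab⟩ := hx
    have hmk : (m : WithBot ℕ) ≤ k := Nat.cast_le.2 hm
    by_contra hx
    refine h ⟨a, b, ?_, ha.trans_le hmk, hb.trans_le hmk, hab⟩
    rintro rfl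
    simp_all

theorem finrank_polySpan {l : F} {m : ℕ} (hm : m ≤ (minpoly R l).natDegree) :
    Module.finrank R ↥(polySpan R l m) = m := by
  rw [polySpan_eq_map_degreeLT, ← LinearMap.range_domRestrict,
    LinearMap.finrank_range_of_inj, finrank_degreeLT]
  have hmt : (m : WithBot ℕ) ≤ (minpoly R l).natDegree := Nat.cast_le.2 hm
  intro c d hcd
  exact Subtype.ext (eq_of_aeval_eq ((mem_degreeLT.1 c.2).trans_le hmt)
    ((mem_degreeLT.1 d.2).trans_le hmt) hcd)

theorem shift_one (S : Submodule R F) : shift R 1 S = S := by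
  ext x
  simp [mem_shift]

theorem shift_mul (α β : F) (S : Submodule R F) :
    shift R (α * β) S = shift R α (shift R β S) := by
  ext x
  simp [mem_shift, mul_assoc]

theorem finrank_shift {α : F} (hα : α ≠ 0) (S : Submodule R F) :
    Module.finrank R ↥(shift R α S) = Module.finrank R ↥S :=
  (Submodule.equivMapOfInjective (LinearMap.mulLeft R α)
    (mul_right_injective₀ hα) S).finrank_eq.symm

theorem shift_eq_self_iff [FiniteDimensional R F] {α : F} (hα : α ≠ 0) (S : Submodule R F) :
    shift R α S = S ↔ Module.finrank R ↥(S ⊓ shift R α S) = Module.finrank R ↥S := by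
  constructor
  · intro h
    rw [h, inf_idem]
  · intro h
    have h1 : S ⊓ shift R α S = S := Submodule.eq_of_le_of_finrank_eq inf_le_left h
    exact (Submodule.eq_of_le_of_finrank_eq (inf_eq_left.1 h1) (finrank_shift hα S).symm).symm

section Finite
variable [Fintype F]

open Classical in
theorem card_filter_ne_zero_mem [Fintype R] (T : Submodule R F) :
    (({x : F | x ≠ 0 ∧ x ∈ T} : Finset F).card : ℤ) =
      (Fintype.card R : ℤ) ^ Module.finrank R ↥T - 1 := by
  have h := Module.card_eq_pow_finrank (K := R) (V := T)
  have h2 : ({x : F | x ≠ 0 ∧ x ∈ T} : Finset F) = ({x : F | x ∈ T} : Finset F).erase 0 := by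
    ext x
    simp
  have h3 : ({x : F | x ∈ T} : Finset F).card = Fintype.card T :=
    (Fintype.card_subtype (fun x => x ∈ T)).symm
  rw [h2, Finset.cast_card_erase_of_mem (by simp), h3, h]
  push_cast
  rfl

theorem sum_card_pow_finrank_inf_shift_sub_one [Fintype R] [DecidableEq F]
    (S : Submodule R F) :
    ∑ α : Fˣ, ((Fintype.card R : ℤ) ^ Module.finrank R ↥(S ⊓ shift R (α : F) S) - 1) =
      ((Fintype.card R : ℤ) ^ Module.finrank R ↥S - 1) ^ 2 := by
  classical
  simp_rw [← card_filter_ne_zero_mem]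
  rw [← Nat.cast_sum, ← Finset.card_sigma, sq, ← Nat.cast_mul, ← Finset.card_product]
  congr 1
  refine Finset.card_bij (fun p _ => (p.2, (p.1 : F)⁻¹ * p.2)) ?_ ?_ ?_
  · rintro ⟨α, x⟩ h
    simp only [Finset.mem_sigma, Finset.mem_univ, true_and, Finset.mem_filter, Submodule.mem_inf,
      mem_shift] at h
    obtain ⟨h0, hS, y, hy, rfl⟩ := h
    have := right_ne_zero_of_mul h0
    simp [hS, hy, this]
  · rintro ⟨α, x⟩ h ⟨β, y⟩ h' heq
    simp only [Finset.mem_sigma, Finset.mem_univ, true_and, Finset.mem_filter] at h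
    simp only [Prod.mk.injEq] at heq
    obtain ⟨rfl, heq⟩ := heq
    have := inv_injective (mul_right_cancel₀ h.1 heq)
    rw [Units.ext this]
  · rintro ⟨x, y⟩ h
    simp only [Finset.mem_product, Finset.mem_filter, Finset.mem_univ, true_and] at h
    obtain ⟨⟨hx, hxS⟩, hy, hyS⟩ := h
    refine ⟨⟨Units.mk0 (x / y) (div_ne_zero hx hy), x⟩, ?_, ?_⟩
    · simp only [Finset.mem_sigma, Finset.mem_univ, true_and, Finset.mem_filter,
        Submodule.mem_inf, mem_shift]
      exact ⟨hx, hxS, y, hyS, by simp [hy]⟩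
    · simp [hx]

open Classical in
theorem omega_mul_card_stabilizer (S : Submodule R F) (i : ℕ) :
    omega R S i * ({γ : Fˣ | shift R (γ : F) S = S} : Finset Fˣ).card =
      ({α : Fˣ | sdist R S (shift R (α : F) S) = 2 * i} : Finset Fˣ).card := by
  have := Fintype.ofFinite (Submodule R F)
  rw [omega, Nat.card_eq_fintype_card, Fintype.card_subtype, ← smul_eq_mul, ← Finset.sum_const,
    Finset.card_eq_sum_card_fiberwise (f := fun α : Fˣ => shift R (α : F) S)
      (s := {α : Fˣ | sdist R S (shift R (α : F) S) = 2 * i})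
      (t := {T : Submodule R F | T ∈ orb R S ∧ sdist R S T = 2 * i})]
  · refine Finset.sum_congr rfl fun T hT => ?_
    simp only [Finset.mem_filter, Finset.mem_univ, true_and] at hT
    obtain ⟨⟨β, hβ, rfl⟩, hd⟩ := hT
    refine Finset.card_bij (fun γ _ => Units.mk0 β hβ * γ) ?_ ?_ ?_
    · intro γ h
      simp only [Finset.mem_filter, Finset.mem_univ, true_and] at h
      simp [shift_mul, h, hd]
    · intro γ _ δ _ h
      exact mul_left_cancel h
    · intro α h
      simp only [Finset.mem_filter, Finset.mem_univ, true_and] at h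
      refine ⟨(Units.mk0 β hβ)⁻¹ * α, ?_, by simp⟩
      simp only [Finset.mem_filter, Finset.mem_univ, true_and, Units.val_mul, shift_mul, h.2]
      rw [← shift_mul]
      simp [hβ, shift_one]
  · intro α h
    simp only [Finset.coe_filter, Finset.mem_univ, true_and, Set.mem_ofPred_eq] at h ⊢
    exact ⟨⟨α, α.ne_zero, rfl⟩, h⟩

end Finite

theorem card_filter_lt_of_sum_pow_sub {ι : Type*} [Fintype ι] {q : ℤ} (hq : 1 < q) {e : ι → ℕ}
    {k : ℕ} (h : ∀ m ≤ k, ∑ a, (q ^ (m - e a) - 1) = (q ^ m - 1) ^ 2) {m : ℕ} (hm : m < k) :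
    (({a | e a < m + 1} : Finset ι).card : ℤ) = q ^ (2 * m + 1) - 1 := by
  have h1 : ∀ a, (q ^ (m + 1 - e a) - 1) - q * (q ^ (m - e a) - 1) =
      (q - 1) * if e a < m + 1 then 1 else 0 := by
    intro a
    split_ifs with ha
    · rw [Nat.succ_sub (Nat.lt_succ_iff.1 ha), pow_succ]
      ring
    · rw [Nat.sub_eq_zero_of_le (by omega), Nat.sub_eq_zero_of_le (by omega)]
      ring
  have h2 : (q - 1) * (({a | e a < m + 1} : Finset ι).card : ℤ) =
      (q - 1) * (q ^ (2 * m + 1) - 1) := by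
    rw [Finset.natCast_card_filter, Finset.mul_sum]
    simp_rw [← h1]
    rw [Finset.sum_sub_distrib, ← Finset.mul_sum, h _ hm, h _ hm.le, Nat.succ_eq_add_one]
    ring
  exact mul_left_cancel₀ (by omega) h2

end
end FWS

open FWS

/-- Theorem 4.4, case `k ≤ t/2`: the weight distribution of the code
generated by `S = ⟨1, λ, …, λ^(k-1)⟩_{F_q}` with `t = [F_q(λ):F_q]` and `1 < k ≤ t/2`:
`ω_{2i} = (q+1) q^(2i-1)` for `1 ≤ i ≤ k-1` and `ω_{2k} = (q^n - q^(2k-1))/(q-1)`. -/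
theorem weight_distribution_polySpan_small
    {Fq F : Type*} [Field Fq] [Field F] [Algebra Fq F] [Fintype Fq] [Fintype F]
    (q n : ℕ) (hq : Fintype.card Fq = q) (hn : Module.finrank Fq F = n)
    (lam : F) (hlam : lam ∉ Set.range (algebraMap Fq F))
    (t : ℕ) (ht : Module.finrank Fq ↥(IntermediateField.adjoin Fq {lam}) = t)
    (k : ℕ) (hk1 : 1 < k) (hk2 : 2 * k ≤ t)
    (S : Submodule Fq F) (hS : S = polySpan Fq lam k) :
    (∀ i : ℕ, 1 ≤ i → i ≤ k - 1 → omega Fq S i = (q + 1) * q ^ (2 * i - 1)) ∧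
    (q - 1) * omega Fq S k = q ^ n - q ^ (2 * k - 1) := by
  classical
  subst hS hq hn ht
  rw [IntermediateField.adjoin.finrank (Algebra.IsIntegral.isIntegral lam)] at hk2
  have hq1 : 1 < Fintype.card Fq := Fintype.one_lt_card
  choose e he using fun α : Fˣ => exists_finrank_inf_shift_polySpan (l := lam) hk2 α.ne_zero
  have hS : ∀ m ≤ k, Module.finrank Fq ↥(polySpan Fq lam m) = m := fun m hm =>
    finrank_polySpan (by omega)
  have hlt : ∀ m < k, (({α | e α < m + 1} : Finset Fˣ).card : ℤ) =
      (Fintype.card Fq : ℤ) ^ (2 * m + 1) - 1 := by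
    intro m hm
    refine card_filter_lt_of_sum_pow_sub (mod_cast hq1) (fun j hj => ?_) hm
    simpa only [he _ j hj, hS j hj] using
      sum_card_pow_finrank_inf_shift_sub_one (polySpan Fq lam j)
  have hstab : (({γ : Fˣ | shift Fq (γ : F) (polySpan Fq lam k) = polySpan Fq lam k} :
      Finset Fˣ).card : ℤ) = Fintype.card Fq - 1 := by
    rw [← pow_one (Fintype.card Fq : ℤ), ← hlt 0 (by omega)]
    congr 2
    ext γ
    rw [Finset.mem_filter_univ, Finset.mem_filter_univ, shift_eq_self_iff γ.ne_zero,
      he γ k le_rfl, hS k le_rfl]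
    omega
  have hdist : ∀ α : Fˣ, sdist Fq (polySpan Fq lam k) (shift Fq (α : F) (polySpan Fq lam k)) =
      2 * min k (e α) := by
    intro α
    rw [sdist, finrank_shift α.ne_zero, he α k le_rfl, hS k le_rfl]
    omega
  have homega : ∀ i, (Fintype.card Fq - 1 : ℤ) * omega Fq (polySpan Fq lam k) i =
      ({α | min k (e α) = i} : Finset Fˣ).card := by
    intro i
    rw [← hstab, mul_comm, ← Nat.cast_mul, omega_mul_card_stabilizer]
    simp [hdist]
  refine ⟨fun i hi hik => ?_, ?_⟩
  · have hsplit : ({α | e α < i + 1} : Finset Fˣ) =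
        ({α | e α < i - 1 + 1} : Finset Fˣ) ∪ ({α | min k (e α) = i} : Finset Fˣ) := by
      ext α
      simp only [Finset.mem_filter, Finset.mem_union, Finset.mem_univ, true_and]
      omega
    have hdisj : Disjoint ({α | e α < i - 1 + 1} : Finset Fˣ)
        ({α | min k (e α) = i} : Finset Fˣ) := by
      rw [Finset.disjoint_filter]
      intro α _
      omega
    have hcard := hlt i (by omega)
    rw [hsplit, Finset.card_union_of_disjoint hdisj, Nat.cast_add, hlt (i - 1) (by omega),
      ← homega] at hcard
    obtain ⟨j, rfl⟩ := Nat.exists_eq_add_of_le' hi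
    have : (Fintype.card Fq - 1 : ℤ) * omega Fq (polySpan Fq lam k) (j + 1) =
        (Fintype.card Fq - 1) * ((Fintype.card Fq + 1) * Fintype.card Fq ^ (2 * j + 1)) := by
      rw [Nat.add_sub_cancel] at hcard
      linear_combination hcard
    have := mul_left_cancel₀ (by omega) this
    exact_mod_cast this
  · have hsplit : (Finset.univ : Finset Fˣ) =
        ({α | e α < k - 1 + 1} : Finset Fˣ) ∪ ({α | min k (e α) = k} : Finset Fˣ) := by
      ext α
      simp only [Finset.mem_filter, Finset.mem_union, Finset.mem_univ, true_and, true_iff]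
      omega
    have hdisj : Disjoint ({α | e α < k - 1 + 1} : Finset Fˣ)
        ({α | min k (e α) = k} : Finset Fˣ) := by
      rw [Finset.disjoint_filter]
      intro α _
      omega
    have hcard : ((Finset.univ : Finset Fˣ).card : ℤ) =
        (Fintype.card Fq : ℤ) ^ Module.finrank Fq F - 1 := by
      rw [Finset.card_univ, Fintype.card_units, Nat.cast_sub Fintype.card_pos,
        Module.card_eq_pow_finrank (K := Fq) (V := F)]
      push_cast
      rfl
    rw [hsplit, Finset.card_union_of_disjoint hdisj, Nat.cast_add, hlt (k - 1) (by omega),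
      ← homega, show 2 * (k - 1) + 1 = 2 * k - 1 by omega] at hcard
    have hsum : (Fintype.card Fq - 1) * omega Fq (polySpan Fq lam k) k +
        Fintype.card Fq ^ (2 * k - 1) = Fintype.card Fq ^ Module.finrank Fq F := by
      zify [hq1.le]
      linear_combination hcard
    omega
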